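/- Let Λ be an artin algebra, M an indecomposable finite length Λ-module, and Y a module with a homogeneous M-filtration. Then every Gabriel-Roiter filtration of Y contains a module isomorphic to M. -/

import Mathlib

/-!
Setting: `k` is a commutative artinian ring and `Λ` an artin `k`-algebra
(an algebra over `k` which is finitely generated as a `k`-module).
All modules considered are `Λ`-modules of finite length (`IsFiniteLength Λ M`),
and `|M|` denotes the length of `M`, implemented as the height
`Order.height (⊤ : Submodule Λ M)` of the lattice of submodules
(for a submodule `N` of an ambient module, its length is `Order.height N`).
-/

universe u v

open Submodule

section GRDefs

variable (Λ : Type u) [Ring Λ]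

/-- A submodule `N` of an ambient module is indecomposable (as a module):
it is nonzero, and whenever it is the direct sum of two submodules, one of them is zero. -/
def IndecSub {Y : Type v} [AddCommGroup Y] [Module Λ Y] (N : Submodule Λ Y) : Prop :=
  N ≠ ⊥ ∧ ∀ A B : Submodule Λ Y, A ≤ N → B ≤ N → A ⊔ B = N → A ⊓ B = ⊥ → A = ⊥ ∨ B = ⊥

/-- A module is indecomposable iff its top submodule is. -/
def IndecMod (M : Type v) [AddCommGroup M] [Module Λ M] : Prop :=
  IndecSub Λ (⊤ : Submodule Λ M)

/-- The length `|M|` of a module, as an extended natural number. -/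
noncomputable def modLen (M : Type v) [AddCommGroup M] [Module Λ M] : ℕ∞ :=
  Order.height (⊤ : Submodule Λ M)

/-- The length `|N|` of a submodule of an ambient module, as a natural number. -/
noncomputable def subLen {Y : Type v} [AddCommGroup Y] [Module Λ Y] (N : Submodule Λ Y) : ℕ :=
  (Order.height N).toNat

open Classical in
/-- Fuel-based auxiliary function for the Gabriel-Roiter measure. -/
noncomputable def muAux {Y : Type v} [AddCommGroup Y] [Module Λ Y] :
    ℕ → Submodule Λ Y → ℝ
  | 0, _ => 0
  | n + 1, N =>
      (if IndecSub Λ N then (2 : ℝ) ^ (-(subLen Λ N : ℤ)) else 0)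
        + sSup (muAux n '' {N' : Submodule Λ Y | N' < N})

/-- The Gabriel-Roiter measure `μ(N)` of a submodule `N` of an ambient module:
`μ(0) = 0`; if `N ≠ 0` is decomposable, `μ(N)` is the maximum of `μ(N')` over proper
submodules `N'` of `N`; if `N` is indecomposable, `μ(N) = 2^(-|N|)` plus this maximum.
(For modules of finite length the supremum is a maximum and the fuel `|N|` suffices for
the recursion, so this agrees with the usual inductive definition; the measure of a
submodule depends only on the sublattice of its submodules, hence it does not matter
in which ambient module it is computed.) -/
noncomputable def mu {Y : Type v} [AddCommGroup Y] [Module Λ Y] (N : Submodule Λ Y) : ℝ :=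
  muAux Λ (subLen Λ N) N

/-- The Gabriel-Roiter measure of a module. -/
noncomputable def muMod (M : Type v) [AddCommGroup M] [Module Λ M] : ℝ :=
  mu Λ (⊤ : Submodule Λ M)

/-- `X` is a Gabriel-Roiter submodule of the (indecomposable, non-simple) ambient
module `Y`: `X` is an indecomposable proper submodule with `μ(Y) = μ(X) + 2^(-|Y|)`. -/
def IsGRSub {Y : Type v} [AddCommGroup Y] [Module Λ Y] (X : Submodule Λ Y) : Prop :=
  IndecMod Λ Y ∧ IndecSub Λ X ∧ X ≠ ⊤ ∧
    mu Λ (⊤ : Submodule Λ Y) = mu Λ X + (2 : ℝ) ^ (-(subLen Λ (⊤ : Submodule Λ Y) : ℤ))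

/-- A map `u : X → Y` is a Gabriel-Roiter inclusion iff it is injective and its
image is a Gabriel-Roiter submodule of `Y`. -/
def IsGRInclusion {X Y : Type v} [AddCommGroup X] [Module Λ X] [AddCommGroup Y] [Module Λ Y]
    (u : X →ₗ[Λ] Y) : Prop :=
  Function.Injective u ∧ IsGRSub Λ (LinearMap.range u)

/-- A linear map is a split monomorphism. -/
def IsSplitMonoHom {A B : Type v} [AddCommGroup A] [Module Λ A] [AddCommGroup B] [Module Λ B]
    (f : A →ₗ[Λ] B) : Prop :=
  ∃ g : B →ₗ[Λ] A, g.comp f = LinearMap.id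

/-- A linear map is a split epimorphism. -/
def IsSplitEpiHom {A B : Type v} [AddCommGroup A] [Module Λ A] [AddCommGroup B] [Module Λ B]
    (f : A →ₗ[Λ] B) : Prop :=
  ∃ g : B →ₗ[Λ] A, f.comp g = LinearMap.id

/-- A morphism `f` in the category of finite length `Λ`-modules is irreducible if it is
neither a split monomorphism nor a split epimorphism and, whenever `f = g ∘ h` with the
intermediate module of finite length, either `h` is a split monomorphism or `g` is a
split epimorphism. -/
def IsIrreducibleHom {A B : Type v} [AddCommGroup A] [Module Λ A] [AddCommGroup B] [Module Λ B]
    (f : A →ₗ[Λ] B) : Prop :=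
  ¬ IsSplitMonoHom Λ f ∧ ¬ IsSplitEpiHom Λ f ∧
    ∀ (Z : Type v) [AddCommGroup Z] [Module Λ Z], IsFiniteLength Λ Z →
      ∀ (h : A →ₗ[Λ] Z) (g : Z →ₗ[Λ] B), f = g.comp h →
        IsSplitMonoHom Λ h ∨ IsSplitEpiHom Λ g

/-- An indecomposable submodule `U` of the ambient module is piling provided
`μ(V) ≤ μ(U)` for every indecomposable submodule `V` with `|V| ≤ |U|`. -/
def IsPilingSub {Y : Type v} [AddCommGroup Y] [Module Λ Y] (U : Submodule Λ Y) : Prop :=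
  IndecSub Λ U ∧ ∀ V : Submodule Λ Y, IndecSub Λ V →
    Order.height V ≤ Order.height U → mu Λ V ≤ mu Λ U

/-- A Gabriel-Roiter filtration `c 0 ⊂ c 1 ⊂ ⋯ ⊂ c t = N` of an (indecomposable)
submodule `N`: a chain of indecomposable submodules starting at a simple module such
that each inclusion `c i ⊂ c (i+1)` is a Gabriel-Roiter inclusion,
i.e. `μ(c (i+1)) = μ(c i) + 2^(-|c (i+1)|)`. -/
def IsGRFiltration {Y : Type v} [AddCommGroup Y] [Module Λ Y] {t : ℕ}
    (c : Fin (t + 1) → Submodule Λ Y) (N : Submodule Λ Y) : Prop :=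
  c (Fin.last t) = N ∧
  IsSimpleModule Λ (c 0) ∧
  (∀ i : Fin (t + 1), IndecSub Λ (c i)) ∧
  ∀ i : Fin t, c i.castSucc < c i.succ ∧
    mu Λ (c i.succ) = mu Λ (c i.castSucc) + (2 : ℝ) ^ (-(subLen Λ (c i.succ) : ℤ))

/-- A brick: a nonzero module all of whose nonzero endomorphisms are invertible
(i.e. the endomorphism ring is a division ring). -/
def IsBrick (M : Type v) [AddCommGroup M] [Module Λ M] : Prop :=
  (∃ x : M, x ≠ 0) ∧ ∀ f : M →ₗ[Λ] M, f ≠ 0 → Function.Bijective f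

/-- An `M`-filtration `0 = c 0 ⊂ c 1 ⊂ ⋯ ⊂ c m = Y` of the module `Y`
(so `c j` is the module `M[j]`, with `M[0] = 0`, and the `M`-length of `Y` is `m`):
all consecutive factors `c (i+1) / c i` are isomorphic to `M`. -/
structure IsMFiltration (M : Type v) [AddCommGroup M] [Module Λ M]
    {Y : Type v} [AddCommGroup Y] [Module Λ Y] {m : ℕ}
    (c : Fin (m + 1) → Submodule Λ Y) : Prop where
  bot : c 0 = ⊥
  top : c (Fin.last m) = ⊤
  lt : ∀ i : Fin m, c i.castSucc < c i.succ
  quot : ∀ i : Fin m,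
    Nonempty ((↥(c i.succ) ⧸ comap (c i.succ).subtype (c i.castSucc)) ≃ₗ[Λ] M)

/-- A homogeneous `M`-filtration: an `M`-filtration in which moreover all the
`M[i] = c i` with `i ≥ 1` are indecomposable and all the inclusions
`M[i-1] ⊂ M[i]` for `2 ≤ i ≤ m` are irreducible monomorphisms. -/
structure IsHomogMFiltration (M : Type v) [AddCommGroup M] [Module Λ M]
    {Y : Type v} [AddCommGroup Y] [Module Λ Y] {m : ℕ}
    (c : Fin (m + 1) → Submodule Λ Y) extends IsMFiltration Λ M c : Prop where
  indec : ∀ i : Fin (m + 1), i ≠ 0 → IndecSub Λ (c i)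
  irr : ∀ i : Fin m, (i : ℕ) ≠ 0 →
    IsIrreducibleHom Λ (Submodule.inclusion (toIsMFiltration.lt i).le)

end GRDefs

section Length

variable {Λ : Type u} [Ring Λ] {A B : Type v} [AddCommGroup A] [Module Λ A]
  [AddCommGroup B] [Module Λ B]

theorem subLen_eq_toNat_length (N : Submodule Λ A) :
    subLen Λ N = (Module.length Λ N).toNat := by
  rw [Module.length_submodule, subLen]

theorem subLen_map {f : A →ₗ[Λ] B} (hf : Function.Injective f) (N : Submodule Λ A) :
    subLen Λ (N.map f) = subLen Λ N := by
  rw [subLen_eq_toNat_length, subLen_eq_toNat_length,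
    (Submodule.equivMapOfInjective f hf N).length_eq]

theorem indecSub_map_iff {f : A →ₗ[Λ] B} (hf : Function.Injective f) (N : Submodule Λ A) :
    IndecSub Λ (N.map f) ↔ IndecSub Λ N := by
  have hinj := Submodule.map_injective_of_injective hf
  have hbot : ∀ P : Submodule Λ A, P.map f = ⊥ ↔ P = ⊥ := fun P =>
    ⟨fun h => hinj (h.trans (Submodule.map_bot f).symm), fun h => by rw [h, Submodule.map_bot]⟩
  constructor
  · rintro ⟨h0, h⟩
    refine ⟨fun h' => h0 ((hbot N).2 h'), fun P Q hP hQ hsup hinf => ?_⟩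
    have := h (P.map f) (Q.map f) (Submodule.map_mono hP) (Submodule.map_mono hQ)
      (by rw [← Submodule.map_sup, hsup])
      (by rw [← Submodule.map_inf f hf, hinf, Submodule.map_bot])
    rwa [hbot, hbot] at this
  · rintro ⟨h0, h⟩
    refine ⟨fun h' => h0 ((hbot N).1 h'), fun P Q hP hQ hsup hinf => ?_⟩
    have key : ∀ R ≤ N.map f, ∃ R' ≤ N, R'.map f = R := fun R hR =>
      ⟨R.comap f, by
        rw [← Submodule.comap_map_eq_of_injective hf N]; exact Submodule.comap_mono hR,
        Submodule.map_comap_eq_of_le (hR.trans (LinearMap.map_le_range))⟩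
    obtain ⟨P, hP', rfl⟩ := key P hP
    obtain ⟨Q, hQ', rfl⟩ := key Q hQ
    rw [hbot, hbot]
    refine h P Q hP' hQ' (hinj (by rw [Submodule.map_sup, hsup])) ?_
    rw [← hbot, Submodule.map_inf f hf, hinf]

theorem muAux_map {f : A →ₗ[Λ] B} (hf : Function.Injective f) (n : ℕ) (N : Submodule Λ A) :
    muAux Λ n (N.map f) = muAux Λ n N := by
  induction n generalizing N with
  | zero => rfl
  | succ n ih =>
    have himg : muAux Λ n '' {N' : Submodule Λ B | N' < N.map f} =
        muAux Λ n '' {N' : Submodule Λ A | N' < N} := by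
      ext x
      constructor
      · rintro ⟨P, hP, rfl⟩
        have hP' : (P.comap f).map f = P :=
          Submodule.map_comap_eq_of_le (le_of_lt hP |>.trans LinearMap.map_le_range)
        refine ⟨P.comap f, ?_, by rw [← ih, hP']⟩
        rw [Set.mem_ofPred_eq, ← hP'] at hP
        exact (Submodule.map_lt_map_iff_of_injective hf).1 hP
      · rintro ⟨P, hP, rfl⟩
        exact ⟨P.map f, (Submodule.map_lt_map_iff_of_injective hf).2 hP, ih P⟩
    rw [muAux, muAux, himg, subLen_map hf]
    congr 2
    exact propext (indecSub_map_iff hf N)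

theorem mu_map {f : A →ₗ[Λ] B} (hf : Function.Injective f) (N : Submodule Λ A) :
    mu Λ (N.map f) = mu Λ N := by
  rw [mu, mu, subLen_map hf, muAux_map hf]

theorem mu_range {f : A →ₗ[Λ] B} (hf : Function.Injective f) :
    mu Λ (LinearMap.range f) = mu Λ (⊤ : Submodule Λ A) := by
  rw [LinearMap.range_eq_map, mu_map hf]

theorem mu_top_coe (N : Submodule Λ A) : mu Λ (⊤ : Submodule Λ N) = mu Λ N := by
  rw [← mu_range N.injective_subtype, Submodule.range_subtype]

theorem subLen_range {f : A →ₗ[Λ] B} (hf : Function.Injective f) :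
    subLen Λ (LinearMap.range f) = subLen Λ (⊤ : Submodule Λ A) := by
  rw [LinearMap.range_eq_map, subLen_map hf]

theorem subLen_top_coe (N : Submodule Λ A) : subLen Λ (⊤ : Submodule Λ N) = subLen Λ N := by
  rw [← subLen_range N.injective_subtype, Submodule.range_subtype]

theorem indecMod_coe_iff (N : Submodule Λ A) : IndecMod Λ N ↔ IndecSub Λ N := by
  rw [IndecMod, ← indecSub_map_iff N.injective_subtype, Submodule.map_subtype_top]

theorem indecSub_range_iff {f : A →ₗ[Λ] B} (hf : Function.Injective f) :
    IndecSub Λ (LinearMap.range f) ↔ IndecMod Λ A := by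
  rw [LinearMap.range_eq_map, indecSub_map_iff hf, IndecMod]

variable [IsNoetherian Λ A] [IsArtinian Λ A]

theorem subLen_strictMono : StrictMono (subLen Λ : Submodule Λ A → ℕ) := by
  intro N N' h
  have hfin : ∀ P : Submodule Λ A, Order.height P ≠ ⊤ := fun P => by
    rw [← Module.length_submodule]; exact Module.length_ne_top
  rw [subLen, subLen, ← ENat.natCast_lt_natCast, ENat.natCast_toNat (hfin _),
    ENat.natCast_toNat (hfin _)]
  exact Order.height_strictMono h (lt_top_iff_ne_top.2 (hfin _))

theorem subLen_range_add_ker (f : A →ₗ[Λ] B) :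
    subLen Λ (LinearMap.range f) + subLen Λ (LinearMap.ker f) =
      subLen Λ (⊤ : Submodule Λ A) := by
  have h := Module.length_eq_add_of_exact (LinearMap.ker f).subtype f.rangeRestrict
    (Submodule.injective_subtype _) f.surjective_rangeRestrict
    (by rw [LinearMap.exact_iff, LinearMap.ker_rangeRestrict, Submodule.range_subtype])
  rw [subLen_eq_toNat_length, subLen_eq_toNat_length, subLen_eq_toNat_length, Module.length_top, h,
    ENat.toNat_add Module.length_ne_top Module.length_ne_top, add_comm]

theorem subLen_range_lt {f : A →ₗ[Λ] B} (hf : LinearMap.ker f ≠ ⊥) :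
    subLen Λ (LinearMap.range f) < subLen Λ (⊤ : Submodule Λ A) := by
  have h := subLen_range_add_ker f
  have := subLen_strictMono (bot_lt_iff_ne_bot.2 hf)
  omega

end Length

section Measure

variable {Λ : Type u} [Ring Λ] {A : Type v} [AddCommGroup A] [Module Λ A]

theorem subLen_bot : subLen Λ (⊥ : Submodule Λ A) = 0 := by
  simp [subLen]

theorem muAux_bot (n : ℕ) : muAux Λ n (⊥ : Submodule Λ A) = 0 := by
  cases n with
  | zero => rfl
  | succ n => simp [muAux, IndecSub]

theorem mu_bot : mu Λ (⊥ : Submodule Λ A) = 0 := muAux_bot _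

variable [IsNoetherian Λ A] [IsArtinian Λ A]

theorem muAux_eq_mu {n : ℕ} {N : Submodule Λ A} (h : subLen Λ N ≤ n) :
    muAux Λ n N = mu Λ N := by
  induction n using Nat.strong_induction_on generalizing N with
  | _ n ih =>
    rcases eq_or_ne N ⊥ with rfl | hN
    · rw [muAux_bot, mu_bot]
    have hpos := subLen_strictMono (bot_lt_iff_ne_bot.2 hN)
    obtain ⟨l, hl⟩ : ∃ l, subLen Λ N = l + 1 := ⟨subLen Λ N - 1, by omega⟩
    obtain ⟨n, rfl⟩ : ∃ n', n = n' + 1 := ⟨n - 1, by omega⟩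
    rw [mu, hl, muAux, muAux]
    congr 2
    refine Set.image_congr fun N' (hN' : N' < N) => ?_
    have := subLen_strictMono hN'
    rw [ih n (by omega) (by omega)]
    rcases Nat.lt_or_ge l (n + 1) with hln | hln
    · rw [ih l hln (by omega)]
    · omega

open Classical in
theorem mu_eq_add_sSup (N : Submodule Λ A) :
    mu Λ N = (if IndecSub Λ N then (2 : ℝ) ^ (-(subLen Λ N : ℤ)) else 0)
        + sSup (mu Λ '' {N' : Submodule Λ A | N' < N}) := by
  rw [← muAux_eq_mu (Nat.le_succ _), muAux]
  congr 2
  exact Set.image_congr fun N' hN' => muAux_eq_mu (subLen_strictMono hN').le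

open Classical in
/-- The measure of `N` is an integral multiple of `2^(-|N|)`, it is at most `1 - 2^(-|N|)`, and the
supremum in its definition is a maximum. -/
theorem mu_integral_and_attained (N : Submodule Λ A) :
    (∃ z : ℕ, mu Λ N * 2 ^ subLen Λ N = z) ∧ mu Λ N * 2 ^ subLen Λ N ≤ 2 ^ subLen Λ N - 1 ∧
      (N ≠ ⊥ → ∃ N' < N, mu Λ N =
        (if IndecSub Λ N then (2 : ℝ) ^ (-(subLen Λ N : ℤ)) else 0) + mu Λ N' ∧
        ∀ N'' < N, mu Λ N'' ≤ mu Λ N') := by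
  induction N using WellFoundedLT.induction with
  | _ N ih =>
    rcases eq_or_ne N ⊥ with rfl | hN
    · exact ⟨⟨0, by simp [mu_bot]⟩, by simp [mu_bot, subLen_bot], fun h => absurd rfl h⟩
    have hpos := subLen_strictMono (bot_lt_iff_ne_bot.2 hN)
    obtain ⟨l, hl⟩ : ∃ l, subLen Λ N = l + 1 := ⟨subLen Λ N - 1, by omega⟩
    have hint : ∀ N' < N, ∃ z : ℕ, mu Λ N' * 2 ^ l = z ∧ z + 1 ≤ 2 ^ l := by
      intro N' hN'
      obtain ⟨⟨z, hz⟩, hle, -⟩ := ih N' hN'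
      have hlt := subLen_strictMono hN'
      obtain ⟨e, he⟩ : ∃ e, l = subLen Λ N' + e := ⟨l - subLen Λ N', by omega⟩
      refine ⟨z * 2 ^ e, by rw [he, pow_add, ← mul_assoc, hz]; push_cast; ring, ?_⟩
      rw [hz] at hle
      have hle' : z + 1 ≤ 2 ^ subLen Λ N' := by
        have : (z : ℝ) + 1 ≤ 2 ^ subLen Λ N' := by linarith
        exact_mod_cast this
      have h1 : 1 ≤ 2 ^ e := Nat.one_le_two_pow
      calc z * 2 ^ e + 1 ≤ (z + 1) * 2 ^ e := by linarith
        _ ≤ 2 ^ subLen Λ N' * 2 ^ e := Nat.mul_le_mul_right _ hle'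
        _ = 2 ^ l := by rw [he, pow_add]
    have h2 : (2 : ℝ) ^ l ≠ 0 := by positivity
    have hfin : (mu Λ '' {N' : Submodule Λ A | N' < N}).Finite := by
      refine ((Finset.range (2 ^ l)).image fun z : ℕ => (z : ℝ) / 2 ^ l).finite_toSet.subset ?_
      rintro _ ⟨N', hN', rfl⟩
      obtain ⟨z, hz, hz'⟩ := hint N' hN'
      simp only [Finset.coe_image, Set.mem_image, Finset.mem_coe, Finset.mem_range]
      exact ⟨z, by omega, by rw [← hz]; field_simp⟩
    have hne : (mu Λ '' {N' : Submodule Λ A | N' < N}).Nonempty :=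
      ⟨_, ⊥, bot_lt_iff_ne_bot.2 hN, rfl⟩
    obtain ⟨N', hN', hsup⟩ := hne.csSup_mem hfin
    have hmu := mu_eq_add_sSup N
    rw [← hsup] at hmu
    obtain ⟨z, hz, hz'⟩ := hint N' hN'
    have hz'' : (z : ℝ) + 1 ≤ 2 ^ l := by exact_mod_cast hz'
    have hexp : (if IndecSub Λ N then (2 : ℝ) ^ (-(subLen Λ N : ℤ)) else 0) * 2 ^ subLen Λ N =
        ((if IndecSub Λ N then 1 else 0 : ℕ) : ℝ) := by
      split_ifs
      · rw [zpow_neg, zpow_natCast]; field_simp; simp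
      · simp
    have hprod : mu Λ N * 2 ^ subLen Λ N =
        (((if IndecSub Λ N then 1 else 0) + z * 2 : ℕ) : ℝ) := by
      rw [hmu, add_mul, hexp]
      push_cast
      rw [← hz, hl, pow_succ]
      ring
    refine ⟨⟨_, hprod⟩, ?_, fun _ => ⟨N', hN', hmu, fun N'' hN'' => ?_⟩⟩
    · rw [hprod, hl, pow_succ]
      push_cast
      split_ifs <;> linarith
    · rw [hsup]
      exact le_csSup hfin.bddAbove ⟨N'', hN'', rfl⟩

theorem exists_mu_mul_two_pow_eq {N : Submodule Λ A} {n : ℕ} (h : subLen Λ N ≤ n) :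
    ∃ z : ℕ, mu Λ N * 2 ^ n = z := by
  obtain ⟨⟨z, hz⟩, -⟩ := mu_integral_and_attained N
  obtain ⟨e, rfl⟩ := Nat.exists_eq_add_of_le h
  exact ⟨z * 2 ^ e, by rw [pow_add, ← mul_assoc, hz]; push_cast; ring⟩

/-- Two different measures of modules of length at most `n` differ by at least `2⁻ⁿ`. -/
theorem mu_add_le_of_lt {B : Type v} [AddCommGroup B] [Module Λ B] [IsNoetherian Λ B]
    [IsArtinian Λ B] {N : Submodule Λ A} {P : Submodule Λ B} {n : ℕ} (hN : subLen Λ N ≤ n)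
    (hP : subLen Λ P ≤ n) (h : mu Λ N < mu Λ P) :
    mu Λ N + (2 : ℝ) ^ (-(n : ℤ)) ≤ mu Λ P := by
  obtain ⟨x, hx⟩ := exists_mu_mul_two_pow_eq hN
  obtain ⟨y, hy⟩ := exists_mu_mul_two_pow_eq hP
  have h2 : (0 : ℝ) < 2 ^ n := by positivity
  have hxy : (x : ℝ) < y := by rw [← hx, ← hy]; exact mul_lt_mul_of_pos_right h h2
  have hxy' : (x : ℝ) + 1 ≤ y := by exact_mod_cast hxy
  refine le_of_mul_le_mul_right ?_ h2
  rw [add_mul, hx, hy, zpow_neg, zpow_natCast, inv_mul_cancel₀ h2.ne']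
  exact hxy'

theorem mu_mono : Monotone (mu Λ : Submodule Λ A → ℝ) := by
  classical
  intro N' N h
  rcases eq_or_lt_of_le h with rfl | h
  · exact le_rfl
  obtain ⟨P, -, hmu, hP⟩ := (mu_integral_and_attained N).2.2 (ne_bot_of_gt h)
  refine (hP N' h).trans ?_
  rw [hmu]
  split_ifs
  · have : (0 : ℝ) < 2 ^ (-(subLen Λ N : ℤ)) := by positivity
    linarith
  · linarith

theorem exists_mu_eq_of_indecSub {N : Submodule Λ A} (hN : IndecSub Λ N) :
    ∃ N' < N, mu Λ N = (2 : ℝ) ^ (-(subLen Λ N : ℤ)) + mu Λ N' ∧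
      ∀ N'' < N, mu Λ N'' ≤ mu Λ N' := by
  classical
  have := (mu_integral_and_attained N).2.2 hN.1
  rwa [if_pos hN] at this

theorem mu_lt_of_lt_of_indecSub {N N' : Submodule Λ A} (hN : IndecSub Λ N) (h : N' < N) :
    mu Λ N' < mu Λ N := by
  obtain ⟨P, -, hmu, hP⟩ := exists_mu_eq_of_indecSub hN
  have := hP N' h
  have : (0 : ℝ) < 2 ^ (-(subLen Λ N : ℤ)) := by positivity
  linarith

theorem exists_indecSub_mu_eq {N : Submodule Λ A} (hN : N ≠ ⊥) :
    ∃ W ≤ N, IndecSub Λ W ∧ mu Λ W = mu Λ N := by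
  classical
  induction N using WellFoundedLT.induction with
  | _ N ih =>
    by_cases hi : IndecSub Λ N
    · exact ⟨N, le_rfl, hi, rfl⟩
    obtain ⟨P, hPN, hmu, hP⟩ := (mu_integral_and_attained N).2.2 hN
    rw [if_neg hi, zero_add] at hmu
    rcases eq_or_ne P ⊥ with rfl | hP0
    · obtain ⟨Q, hQ0, hQN⟩ : ∃ Q : Submodule Λ A, Q ≠ ⊥ ∧ Q < N := by
        by_contra! hcon
        refine hi ⟨hN, fun S T hS hT hsup hinf => ?_⟩
        by_contra! h
        have h1 : S = N := hS.eq_of_not_lt (hcon S h.1)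
        have h2 : T = N := hT.eq_of_not_lt (hcon T h.2)
        rw [h1, h2, inf_idem] at hinf
        exact hN hinf
      obtain ⟨W, hW, hWi, hWmu⟩ := ih Q hQN hQ0
      exact ⟨W, hW.trans hQN.le, hWi, le_antisymm (mu_mono (hW.trans hQN.le))
        (by rw [hmu, mu_bot, ← mu_bot (Λ := Λ) (A := A)]; exact mu_mono bot_le)⟩
    · obtain ⟨W, hW, hWi, hWmu⟩ := ih P hPN hP0
      exact ⟨W, hW.trans hPN.le, hWi, hWmu.trans hmu.symm⟩

theorem mu_pos {N : Submodule Λ A} (hN : N ≠ ⊥) : 0 < mu Λ N := by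
  obtain ⟨W, -, hWi, hWmu⟩ := exists_indecSub_mu_eq hN
  rw [← hWmu, ← mu_bot (Λ := Λ) (A := A)]
  exact mu_lt_of_lt_of_indecSub hWi (bot_lt_iff_ne_bot.2 hWi.1)

end Measure

section MainProperty

variable {Λ : Type u} [Ring Λ]

/-- If two maps out of an indecomposable module `V` are jointly injective but neither of them is
injective, then the measure of one of the images exceeds that of `V`. -/
def MainProperty (Λ : Type u) [Ring Λ] (V : Type v) [AddCommGroup V] [Module Λ V] : Prop :=
  ∀ (A B : Type v) [AddCommGroup A] [Module Λ A] [IsNoetherian Λ A] [IsArtinian Λ A]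
    [AddCommGroup B] [Module Λ B] [IsNoetherian Λ B] [IsArtinian Λ B]
    (f : V →ₗ[Λ] A) (g : V →ₗ[Λ] B), LinearMap.ker f ⊓ LinearMap.ker g = ⊥ →
      (Function.Injective f ∨ mu Λ (⊤ : Submodule Λ V) < mu Λ (LinearMap.range f)) ∨
      (Function.Injective g ∨ mu Λ (⊤ : Submodule Λ V) < mu Λ (LinearMap.range g))

variable {V : Type v} [AddCommGroup V] [Module Λ V] [IsNoetherian Λ V] [IsArtinian Λ V]

/-- An injective restriction of an epimorphism `h` to a proper submodule `W` of an
indecomposable module strictly increases the measure. -/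
theorem mu_lt_of_surjective_of_injective_comp {W : Submodule Λ V} (hV : IndecMod Λ V)
    (hW : W ≠ ⊥) (hWV : W < ⊤) (hP : MainProperty Λ W) (n : ℕ) :
    ∀ (Z : Type v) [AddCommGroup Z] [Module Λ Z] [IsNoetherian Λ Z] [IsArtinian Λ Z]
      (h : V →ₗ[Λ] Z), subLen Λ (⊤ : Submodule Λ Z) = n → Function.Surjective h →
      Function.Injective (h ∘ₗ W.subtype) → mu Λ W < mu Λ (⊤ : Submodule Λ Z) := by
  induction n using Nat.strong_induction_on with
  | _ n ih =>
    intro Z _ _ _ _ h hn hsurj hinj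
    by_contra! hle
    have hrange : LinearMap.range (h ∘ₗ W.subtype) = W.map h := by
      rw [LinearMap.range_comp, Submodule.range_subtype]
    have hmap : mu Λ (W.map h) = mu Λ W := by
      rw [← hrange, mu_range hinj, mu_top_coe]
    by_cases hZ : IndecSub Λ (⊤ : Submodule Λ Z)
    · have htop : W.map h = ⊤ := by
        by_contra hne
        have := mu_lt_of_lt_of_indecSub hZ (lt_top_iff_ne_top.2 hne)
        linarith
      have hsup : W ⊔ LinearMap.ker h = ⊤ := by
        rw [← Submodule.comap_map_eq, htop, Submodule.comap_top]
      have hinf : W ⊓ LinearMap.ker h = ⊥ := by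
        rw [eq_bot_iff]
        rintro x ⟨hxW, hx⟩
        have : (⟨x, hxW⟩ : W) = 0 := hinj (by simpa using hx)
        simpa using congrArg Subtype.val this
      rcases hV.2 W _ le_top le_top hsup hinf with h0 | h0
      · exact hW h0
      · rw [h0, sup_bot_eq] at hsup
        exact hWV.ne hsup
    · have hZ0 : (⊤ : Submodule Λ Z) ≠ ⊥ := by
        intro h0
        have := mu_pos hW
        have h1 : mu Λ (W.map h) ≤ mu Λ (⊤ : Submodule Λ Z) := mu_mono le_top
        rw [h0, mu_bot] at h1
        linarith
      obtain ⟨A, B, hsup, hinf, hA, hB⟩ : ∃ A B : Submodule Λ Z, A ⊔ B = ⊤ ∧ A ⊓ B = ⊥ ∧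
          A ≠ ⊥ ∧ B ≠ ⊥ := by
        by_contra! hcon
        exact hZ ⟨hZ0, fun A B _ _ hsup hinf => or_iff_not_imp_left.2 (hcon A B hsup hinf)⟩
      have hc : IsCompl A B := ⟨disjoint_iff.2 hinf, codisjoint_iff.2 hsup⟩
      have step : ∀ A B : Submodule Λ Z, ∀ hc : IsCompl A B, B ≠ ⊥ →
          ¬ (Function.Injective ((A.projectionOnto B hc ∘ₗ h) ∘ₗ W.subtype) ∨
            mu Λ (⊤ : Submodule Λ W) <
              mu Λ (LinearMap.range ((A.projectionOnto B hc ∘ₗ h) ∘ₗ W.subtype))) := by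
        intro A B hc hB hor
        have hAle : mu Λ (⊤ : Submodule Λ A) ≤ mu Λ W := by
          rw [mu_top_coe]; exact (mu_mono le_top).trans hle
        rcases hor with hi | hlt
        · have hAlt : A < ⊤ := by
            refine lt_top_iff_ne_top.2 fun hA => hB ?_
            simpa [hA] using hc.inf_eq_bot
          refine absurd (ih (subLen Λ (⊤ : Submodule Λ A)) ?_ A (A.projectionOnto B hc ∘ₗ h) rfl
            ((Submodule.projectionOnto_surjective hc).comp hsurj) hi) (not_lt.2 hAle)
          rw [subLen_top_coe, ← hn]
          exact subLen_strictMono hAlt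
        · have h1 := mu_mono (Λ := Λ) (le_top (a :=
            LinearMap.range ((A.projectionOnto B hc ∘ₗ h) ∘ₗ W.subtype)))
          rw [mu_top_coe] at hlt
          linarith
      refine (hP A B ((A.projectionOnto B hc ∘ₗ h) ∘ₗ W.subtype)
        ((B.projectionOnto A hc.symm ∘ₗ h) ∘ₗ W.subtype) ?_).elim
        (step A B hc hB) (step B A hc.symm hA)
      rw [eq_bot_iff]
      rintro x ⟨hx1, hx2⟩
      simp only [SetLike.mem_coe, LinearMap.mem_ker, LinearMap.comp_apply,
        Submodule.projectionOnto_apply_eq_zero_iff] at hx1 hx2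
      have h0 : h (W.subtype x) = 0 := by
        rw [← Submodule.mem_bot Λ, ← hinf]
        exact ⟨hx2, hx1⟩
      exact hinj (by simpa using h0)

theorem mainProperty_of_indecMod (hV : IndecMod Λ V) : MainProperty Λ V := by
  obtain ⟨n, hn⟩ : ∃ n, subLen Λ (⊤ : Submodule Λ V) = n := ⟨_, rfl⟩
  induction n using Nat.strong_induction_on generalizing V with
  | _ n ih =>
    intro A B _ _ _ _ _ _ _ _ f g hker
    by_contra! hcon
    obtain ⟨⟨hf, hfmu⟩, hg, hgmu⟩ := hcon
    rw [← LinearMap.ker_eq_bot] at hf hg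
    obtain ⟨W', hW'V, hmu, hW'⟩ := exists_mu_eq_of_indecSub hV
    have hW'0 : W' ≠ ⊥ := by
      rintro rfl
      have h1 : LinearMap.ker f < ⊤ :=
        lt_top_iff_ne_top.2 fun h => hg (by rwa [h, top_inf_eq] at hker)
      have := hW' _ h1
      rw [mu_bot] at this
      exact (mu_pos hf).not_ge this
    obtain ⟨W, hWle, hWi, hWmu⟩ := exists_indecSub_mu_eq hW'0
    have hWV : W < ⊤ := hWle.trans_lt hW'V
    have hP : MainProperty Λ W := ih _ (by rw [subLen_top_coe, ← hn]; exact subLen_strictMono hWV)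
      ((indecMod_coe_iff W).2 hWi) rfl
    have step : ∀ (A : Type v) [AddCommGroup A] [Module Λ A] [IsNoetherian Λ A] [IsArtinian Λ A]
        (f : V →ₗ[Λ] A), LinearMap.ker f ≠ ⊥ →
        mu Λ (LinearMap.range f) ≤ mu Λ (⊤ : Submodule Λ V) →
        ¬ (Function.Injective (f ∘ₗ W.subtype) ∨
          mu Λ (⊤ : Submodule Λ W) < mu Λ (LinearMap.range (f ∘ₗ W.subtype))) := by
      intro A _ _ _ _ f hf hfmu hor
      have hlt : mu Λ W < mu Λ (LinearMap.range f) := by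
        rcases hor with hi | hlt
        · rw [← mu_top_coe (LinearMap.range f)]
          refine mu_lt_of_surjective_of_injective_comp hV hWi.1 hWV hP _ _ f.rangeRestrict rfl
            f.surjective_rangeRestrict fun x y hxy => hi ?_
          simpa [Subtype.ext_iff] using hxy
        · rw [mu_top_coe] at hlt
          exact hlt.trans_le (mu_mono (LinearMap.range_comp_le_range _ _))
      have hfl := subLen_range_lt hf
      obtain ⟨l, hl⟩ : ∃ l, subLen Λ (⊤ : Submodule Λ V) = l + 1 :=
        ⟨subLen Λ (⊤ : Submodule Λ V) - 1, by omega⟩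
      have hWl := subLen_strictMono hWV
      have h1 := mu_add_le_of_lt (n := l) (by omega) (by omega) hlt
      have h2 : (2 : ℝ) ^ (-((l + 1 : ℕ) : ℤ)) < 2 ^ (-(l : ℤ)) :=
        zpow_lt_zpow_right₀ (by norm_num) (by push_cast; omega)
      rw [hmu, hl, ← hWmu] at hfmu
      linarith
    refine (hP A B (f ∘ₗ W.subtype) (g ∘ₗ W.subtype) ?_).elim (step A f hf hfmu) (step B g hg hgmu)
    rw [LinearMap.ker_comp, LinearMap.ker_comp, ← Submodule.comap_inf, hker]
    exact LinearMap.ker_eq_bot.2 W.injective_subtype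

end MainProperty

section Filtration

variable {Λ : Type u} [Ring Λ] {M : Type v} [AddCommGroup M] [Module Λ M]
  {Y : Type v} [AddCommGroup Y] [Module Λ Y]

/-- The kernel of the epimorphism onto `M` given by a factor of an `M`-filtration. -/
theorem exists_surjective_ker_eq_comap {C D : Submodule Λ Y}
    (e : Nonempty ((↥D ⧸ comap D.subtype C) ≃ₗ[Λ] M)) :
    ∃ q : D →ₗ[Λ] M, Function.Surjective q ∧ LinearMap.ker q = comap D.subtype C := by
  obtain ⟨e⟩ := e
  refine ⟨e.toLinearMap ∘ₗ (comap D.subtype C).mkQ,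
    e.surjective.comp (Submodule.mkQ_surjective _), ?_⟩
  rw [LinearMap.ker_comp, LinearEquiv.ker, Submodule.comap_bot, Submodule.ker_mkQ]

variable [IsNoetherian Λ M] [IsArtinian Λ M] [IsNoetherian Λ Y] [IsArtinian Λ Y]

/-- If `D / C ≅ M` and `C` is a direct summand of every proper submodule of `D` containing it, then
a bound by `μ(M)` for the submodules of `C` of length at most `|M|` passes on to those of `D`. -/
theorem mu_le_of_retraction {C D : Submodule Λ Y} (hCD : C ≤ D) (hM : IndecMod Λ M)
    (q : D →ₗ[Λ] M) (hq : Function.Surjective q)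
    (hqker : LinearMap.ker q = comap D.subtype C)
    (hsplit : ∀ W : Submodule Λ Y, W < D → ∀ hCW : C ≤ W,
      ∃ r : W →ₗ[Λ] C, r ∘ₗ Submodule.inclusion hCW = LinearMap.id)
    (ih : ∀ V ≤ C, IndecSub Λ V → subLen Λ V ≤ subLen Λ (⊤ : Submodule Λ M) →
      mu Λ V ≤ mu Λ (⊤ : Submodule Λ M) ∧
        (mu Λ V = mu Λ (⊤ : Submodule Λ M) → Nonempty (V ≃ₗ[Λ] M)))
    {V : Submodule Λ Y} (hVD : V ≤ D) (hV : IndecSub Λ V)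
    (hlen : subLen Λ V ≤ subLen Λ (⊤ : Submodule Λ M)) :
    mu Λ V ≤ mu Λ (⊤ : Submodule Λ M) ∧
      (mu Λ V = mu Λ (⊤ : Submodule Λ M) → Nonempty (V ≃ₗ[Λ] M)) := by
  have hker : ∀ x : V, q (Submodule.inclusion hVD x) = 0 ↔ (x : Y) ∈ C := fun x => by
    rw [← LinearMap.mem_ker, hqker]; rfl
  by_cases hsurj : Function.Surjective (q ∘ₗ Submodule.inclusion hVD)
  · have hkerV : LinearMap.ker (q ∘ₗ Submodule.inclusion hVD) = ⊥ := by
      by_contra hne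
      have h1 := subLen_range_lt hne
      rw [LinearMap.range_eq_top.2 hsurj, subLen_top_coe] at h1
      omega
    have e : V ≃ₗ[Λ] M := LinearEquiv.ofBijective _ ⟨LinearMap.ker_eq_bot.1 hkerV, hsurj⟩
    refine ⟨?_, fun _ => ⟨e⟩⟩
    rw [← mu_top_coe V, ← mu_range (f := e.toLinearMap) e.injective]
    exact mu_mono le_top
  have hWD : V ⊔ C < D := by
    refine (sup_le hVD hCD).lt_of_ne fun h => hsurj fun y => ?_
    obtain ⟨⟨d, hd⟩, rfl⟩ := hq y
    obtain ⟨a, ha, b, hb, rfl⟩ := Submodule.mem_sup.1 (h ▸ hd : d ∈ V ⊔ C)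
    refine ⟨⟨a, ha⟩, ?_⟩
    have hb0 : q ⟨b, hCD hb⟩ = 0 := by
      rw [← LinearMap.mem_ker, hqker]; exact hb
    have : (⟨a + b, hd⟩ : D) = ⟨a, hVD ha⟩ + ⟨b, hCD hb⟩ := rfl
    rw [this, map_add, hb0, add_zero]
    rfl
  obtain ⟨r, hr⟩ := hsplit _ hWD le_sup_right
  have hrange : LinearMap.range (q ∘ₗ Submodule.inclusion hVD) < ⊤ :=
    lt_top_iff_ne_top.2 fun h => hsurj (LinearMap.range_eq_top.1 h)
  have hmurange := mu_lt_of_lt_of_indecSub hM hrange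
  set f : V →ₗ[Λ] C := r ∘ₗ Submodule.inclusion le_sup_left with hf
  set f' : V →ₗ[Λ] Y := C.subtype ∘ₗ f with hf'
  have hf'C : LinearMap.range f' ≤ C := by
    rw [hf', LinearMap.range_comp]; exact Submodule.map_subtype_le _ _
  have hjoint : LinearMap.ker f' ⊓ LinearMap.ker (q ∘ₗ Submodule.inclusion hVD) = ⊥ := by
    rw [eq_bot_iff]
    rintro x ⟨hx1, hx2⟩
    have hxC : (x : Y) ∈ C := (hker x).1 hx2
    have hrx : r (Submodule.inclusion le_sup_right (⟨x, hxC⟩ : C)) = ⟨x, hxC⟩ :=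
      LinearMap.congr_fun hr _
    have hx1' : ((r (Submodule.inclusion le_sup_left x) : C) : Y) = 0 := hx1
    have : (x : Y) = 0 := by
      rw [← hx1']
      exact (congrArg Subtype.val hrx).symm
    simpa using this
  rcases mainProperty_of_indecMod ((indecMod_coe_iff V).2 hV) Y M f'
      (q ∘ₗ Submodule.inclusion hVD) hjoint with (hi | hlt) | (hi | hlt)
  · have h1 := ih (LinearMap.range f') hf'C
      ((indecSub_range_iff hi).2 ((indecMod_coe_iff V).2 hV))
      (by rw [subLen_range hi, subLen_top_coe]; exact hlen)
    rw [mu_range hi, mu_top_coe] at h1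
    exact ⟨h1.1, fun h => (h1.2 h).map fun e => (LinearEquiv.ofInjective f' hi).trans e⟩
  · rw [mu_top_coe] at hlt
    have h0 : LinearMap.range f' ≠ ⊥ := by
      intro h0
      rw [h0, mu_bot] at hlt
      exact hlt.not_gt (mu_pos hV.1)
    obtain ⟨W, hW, hWi, hWmu⟩ := exists_indecSub_mu_eq h0
    have h2 := subLen_range_add_ker f'
    rw [subLen_top_coe] at h2
    have h3 := subLen_strictMono.monotone hW
    have h1 := (ih W (hW.trans hf'C) hWi (by omega)).1
    have h4 : mu Λ V < mu Λ (⊤ : Submodule Λ M) := by linarith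
    exact ⟨h4.le, fun h => absurd h h4.ne⟩
  · rw [mu_range hi, mu_top_coe] at hmurange
    exact ⟨hmurange.le, fun h => absurd h hmurange.ne⟩
  · rw [mu_top_coe] at hlt
    have h4 := hlt.trans hmurange
    exact ⟨h4.le, fun h => absurd h h4.ne⟩

/-- `M` is piling in a module with a homogeneous `M`-filtration, and up to isomorphism it is the
only submodule of length at most `|M|` of measure `μ(M)`. -/
theorem mu_le_of_isHomogMFiltration (hM : IndecMod Λ M) {m : ℕ}
    {c : Fin (m + 1) → Submodule Λ Y} (hc : IsHomogMFiltration Λ M c) (i : Fin (m + 1)) :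
    ∀ V ≤ c i, IndecSub Λ V → subLen Λ V ≤ subLen Λ (⊤ : Submodule Λ M) →
      mu Λ V ≤ mu Λ (⊤ : Submodule Λ M) ∧
        (mu Λ V = mu Λ (⊤ : Submodule Λ M) → Nonempty (V ≃ₗ[Λ] M)) := by
  induction i using Fin.induction with
  | zero =>
    intro V hV hVi
    rw [hc.bot, le_bot_iff] at hV
    exact absurd hV hVi.1
  | succ i ih =>
    intro V hV hVi hlen
    obtain ⟨q, hq, hqker⟩ := exists_surjective_ker_eq_comap (hc.quot i)
    refine mu_le_of_retraction (hc.lt i).le hM q hq hqker ?_ ih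
      hV hVi hlen
    intro W hW hCW
    by_cases hi : (i : ℕ) = 0
    · have h0 : c i.castSucc = ⊥ := by
        rw [← hc.bot]; congr 1; exact Fin.ext hi
      refine ⟨0, LinearMap.ext fun x => Subtype.ext ?_⟩
      have hx : (x : Y) = 0 := (Submodule.mem_bot Λ).1 (h0.le x.2)
      simpa using hx.symm
    · rcases (hc.irr i hi).2.2 W (isFiniteLength_iff_isNoetherian_isArtinian.2
          ⟨inferInstance, inferInstance⟩) (Submodule.inclusion hCW)
          (Submodule.inclusion hW.le) rfl with h | ⟨s, hs⟩
      · exact h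
      · refine absurd (fun x hx => ?_) hW.not_ge
        have := congrArg Subtype.val (LinearMap.congr_fun hs ⟨x, hx⟩)
        rw [← show ((s ⟨x, hx⟩ : W) : Y) = x from this]
        exact (s ⟨x, hx⟩).2

end Filtration

/-- Let `M` be indecomposable and `Y` a module with a homogeneous
`M`-filtration. Then every Gabriel-Roiter filtration of `Y` contains a module
isomorphic to `M`. -/
theorem gabriel_roiter_stmt14
    (k : Type u) [CommRing k] [IsArtinianRing k]
    (Λ : Type u) [Ring Λ] [Algebra k Λ] [Module.Finite k Λ]
    (M : Type v) [AddCommGroup M] [Module Λ M] (hMfl : IsFiniteLength Λ M)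
    (hMind : IndecMod Λ M)
    (Y : Type v) [AddCommGroup Y] [Module Λ Y] (hYfl : IsFiniteLength Λ Y)
    (m : ℕ) (c : Fin (m + 1) → Submodule Λ Y) (hc : IsHomogMFiltration Λ M c) :
    ∀ (t : ℕ) (d : Fin (t + 1) → Submodule Λ Y),
      IsGRFiltration Λ d (⊤ : Submodule Λ Y) →
        ∃ i : Fin (t + 1), Nonempty (↥(d i) ≃ₗ[Λ] M) := by
  intro t d hd
  obtain ⟨_, _⟩ := isFiniteLength_iff_isNoetherian_isArtinian.1 hMfl
  obtain ⟨_, _⟩ := isFiniteLength_iff_isNoetherian_isArtinian.1 hYfl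
  obtain ⟨hdtop, hdsimple, hdindec, hdstep⟩ := hd
  have hYi : IndecSub Λ (⊤ : Submodule Λ Y) := hdtop ▸ hdindec (Fin.last t)
  have key := fun V : Submodule Λ Y => mu_le_of_isHomogMFiltration hMind hc (Fin.last m) V
    (hc.top ▸ le_top)
  set L := subLen Λ (⊤ : Submodule Λ M) with hL
  have hLpos : 1 ≤ L := by
    have := subLen_strictMono (bot_lt_iff_ne_bot.2 hMind.1)
    omega
  have hMY : mu Λ (⊤ : Submodule Λ M) ≤ mu Λ (⊤ : Submodule Λ Y) := by
    obtain ⟨m, rfl⟩ : ∃ m', m = m' + 1 := by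
      refine Nat.exists_eq_succ_of_ne_zero ?_
      rintro rfl
      exact hYi.1 (hc.top.symm.trans hc.bot)
    obtain ⟨q, hq, hqker⟩ := exists_surjective_ker_eq_comap (hc.quot 0)
    have hqinj : Function.Injective q := by
      rw [← LinearMap.ker_eq_bot, hqker, Fin.castSucc_zero, hc.bot, Submodule.comap_bot]
      exact LinearMap.ker_eq_bot.2 (Submodule.injective_subtype _)
    rw [← LinearMap.range_eq_top.2 hq, mu_range hqinj, mu_top_coe]
    exact mu_mono le_top
  by_contra! hno
  have hlt : ∀ j, subLen Λ (d j) ≤ L → mu Λ (d j) < mu Λ (⊤ : Submodule Λ M) := fun j hj =>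
    (key (d j) (hdindec j) hj).1.lt_of_ne fun h => (not_nonempty_iff.2 (hno j))
      ((key (d j) (hdindec j) hj).2 h)
  have hmain : ∀ j, subLen Λ (d j) ≤ L ∨
      mu Λ (d j) + (2 : ℝ) ^ (-(subLen Λ (d j) : ℤ)) ≤ mu Λ (⊤ : Submodule Λ M) := by
    intro j
    induction j using Fin.induction with
    | zero =>
      left
      rwa [subLen_eq_toNat_length, Module.length_eq_one, ENat.toNat_one]
    | succ j ih =>
      rw [or_iff_not_imp_left, not_le]
      intro hj
      obtain ⟨hdlt, hdmu⟩ := hdstep j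
      have hbound : ∀ n : ℕ, n < subLen Λ (d j.succ) →
          mu Λ (d j.castSucc) + (2 : ℝ) ^ (-(n : ℤ)) ≤ mu Λ (⊤ : Submodule Λ M) →
          mu Λ (d j.succ) + (2 : ℝ) ^ (-(subLen Λ (d j.succ) : ℤ)) ≤
            mu Λ (⊤ : Submodule Λ M) := by
        intro n hn hle
        have h1 : (2 : ℝ) ^ (-(subLen Λ (d j.succ) : ℤ) + 1) ≤ 2 ^ (-(n : ℤ)) :=
          zpow_le_zpow_right₀ (by norm_num) (by omega)
        rw [zpow_add_one₀ (by norm_num)] at h1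
        linarith
      rcases ih with h | h
      · exact hbound L hj (mu_add_le_of_lt h le_rfl (hlt _ h))
      · exact hbound _ (subLen_strictMono hdlt) h
  rcases hmain (Fin.last t) with h | h
  · have := hlt _ h
    rw [hdtop] at this
    linarith
  · have : (0 : ℝ) < 2 ^ (-(subLen Λ (d (Fin.last t)) : ℤ)) := by positivity
    rw [hdtop] at h this
    linarith
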